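/- arXiv:1403.4385 — 2 statements merged into one kernel-verified Lean document; each statement's English description precedes it below -/
import Mathlib

section
/- Let A and B be simple unital complex C*-algebras, φ : GL(A) → GL(B) a group isomorphism, and θ the induced map on idempotents. Suppose e, f ∈ Ĩ(A) are orthogonal nontrivial idempotents (ef = fe = 0). Then θ(e + f) = θ(e)θ(1 − f) + θ(1 − e)θ(f) and θ(1 − e − f) = θ(e)θ(f) + θ(1 − e)θ(1 − f). -/
noncomputable section

/-- The symmetry `1 - 2e` associated to an idempotent `e` is a unit (its own inverse). -/
def symUnit {A : Type*} [Ring A] {e : A} (he : IsIdempotentElem e) : Aˣ where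
  val := 1 - 2 * e
  inv := 1 - 2 * e
  val_inv := by
    have h : e * e = e := he
    have expand : (1 - 2 * e) * (1 - 2 * e) = 1 - 4 * e + 4 * (e * e) := by noncomm_ring
    rw [expand, h]; noncomm_ring
  inv_val := by
    have h : e * e = e := he
    have expand : (1 - 2 * e) * (1 - 2 * e) = 1 - 4 * e + 4 * (e * e) := by noncomm_ring
    rw [expand, h]; noncomm_ring

/-- The map `θ_φ` induced on idempotents by a map `φ` between the groups of invertible
elements, determined by `1 - 2 θ_φ(e) = φ(1 - 2e)`, i.e. `θ_φ(e) = (1 - φ(1 - 2e))/2`;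
it is extended by `0` off the set of idempotents. -/
noncomputable def theta {A B : Type*} [Ring A] [Ring B] [Algebra ℂ B]
    (φ : Aˣ → Bˣ) (e : A) : B :=
  letI := Classical.propDecidable (IsIdempotentElem e)
  if h : IsIdempotentElem e then (2 : ℂ)⁻¹ • ((1 : B) - (φ (symUnit h) : B)) else 0

variable {A B : Type*}
  [NormedRing A] [StarRing A] [CStarRing A] [CompleteSpace A]
  [NormedAlgebra ℂ A] [StarModule ℂ A]
  [NormedRing B] [StarRing B] [CStarRing B] [CompleteSpace B]
  [NormedAlgebra ℂ B] [StarModule ℂ B]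


theorem Units.val_mem_center_of_forall_commute {R : Type*} [NormedRing R] [NormedAlgebra ℂ R]
    [CompleteSpace R] {z : Rˣ} (hz : ∀ w : Rˣ, w * z = z * w) :
    (z : R) ∈ Subring.center R := by
  rw [Subring.mem_center_iff]
  intro x
  obtain ⟨r, hr⟩ := (Set.ne_univ_iff_exists_notMem _).1 (spectrum.isCompact (𝕜 := ℂ) x).ne_univ
  obtain ⟨w, hw⟩ := spectrum.notMem_iff.1 hr
  have h : (w : R) * z = z * w := by exact_mod_cast congrArg Units.val (hz w)
  rw [hw, sub_mul, mul_sub, Algebra.commutes] at h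
  exact sub_right_injective h

theorem Subring.eq_one_or_eq_neg_one_of_mem_center {R : Type*} [Ring R] [IsSimpleRing R] {z : R}
    (hz : z ∈ Subring.center R) (h : z * z = 1) : z = 1 ∨ z = -1 := by
  let := (IsSimpleRing.isField_center R).toField
  have h' : (⟨z, hz⟩ : Subring.center R) * ⟨z, hz⟩ = 1 := Subtype.ext h
  exact (mul_self_eq_one_iff.1 h').imp (congrArg Subtype.val) (congrArg Subtype.val)

theorem MulEquiv.map_neg_one_units {R S : Type*} [Ring R] [NormedRing S] [NormedAlgebra ℂ S]
    [CompleteSpace S] [IsSimpleRing S] (φ : Rˣ ≃* Sˣ) (hR : (-1 : Rˣ) ≠ 1) :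
    φ (-1) = -1 := by
  have hc : ((φ (-1) : Sˣ) : S) ∈ Subring.center S :=
    Units.val_mem_center_of_forall_commute fun w => by
      obtain ⟨v, rfl⟩ := φ.surjective w
      rw [← map_mul, ← map_mul, mul_neg_one, neg_one_mul]
  have hs : ((φ (-1) : Sˣ) : S) * (φ (-1) : Sˣ) = 1 := by
    rw [← Units.val_mul, ← map_mul, neg_mul_neg, one_mul, map_one, Units.val_one]
  rcases Subring.eq_one_or_eq_neg_one_of_mem_center hc hs with h | h
  · exact absurd (φ.injective ((Units.ext h).trans (map_one φ).symm)) hR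
  · exact Units.ext h

theorem symUnit_one_sub {R : Type*} [Ring R] {e : R} (he : IsIdempotentElem e) :
    symUnit he.one_sub = -1 * symUnit he := by
  ext
  simp only [symUnit, Units.val_mul, Units.val_neg, Units.val_one]
  noncomm_ring

theorem symUnit_add {R : Type*} [Ring R] {e f : R} (he : IsIdempotentElem e)
    (hf : IsIdempotentElem f) (hef : e * f = 0) (h : IsIdempotentElem (e + f)) :
    symUnit h = symUnit he * symUnit hf := by
  ext
  simp only [symUnit, Units.val_mul]
  have : (1 - 2 * e) * (1 - 2 * f) = 1 - 2 * (e + f) + 4 * (e * f) := by noncomm_ring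
  rw [this, hef, mul_zero, add_zero]

theorem theta_of_isIdempotentElem {R S : Type*} [Ring R] [Ring S] [Algebra ℂ S]
    (φ : Rˣ → Sˣ) {e : R} (he : IsIdempotentElem e) :
    theta φ e = (2 : ℂ)⁻¹ • ((1 : S) - (φ (symUnit he) : S)) :=
  dif_pos he

theorem theta_one_sub {R S : Type*} [Ring R] [Ring S] [Algebra ℂ S] (φ : Rˣ ≃* Sˣ)
    (hφ : φ (-1) = -1) {e : R} (he : IsIdempotentElem e) :
    theta φ (1 - e) = (2 : ℂ)⁻¹ • ((1 : S) + (φ (symUnit he) : S)) := by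
  rw [theta_of_isIdempotentElem _ he.one_sub, symUnit_one_sub he, map_mul, hφ, neg_one_mul,
    Units.val_neg, sub_neg_eq_add]

theorem statement7 [IsSimpleRing A] [IsSimpleRing B] (φ : Aˣ ≃* Bˣ)
    (e f : A) (he : IsIdempotentElem e) (he0 : e ≠ 0) (he1 : e ≠ 1)
    (hf : IsIdempotentElem f) (hf0 : f ≠ 0) (hf1 : f ≠ 1)
    (hef : e * f = 0) (hfe : f * e = 0) :
    theta (⇑φ) (e + f) =
      theta (⇑φ) e * theta (⇑φ) (1 - f) + theta (⇑φ) (1 - e) * theta (⇑φ) f ∧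
    theta (⇑φ) (1 - e - f) =
      theta (⇑φ) e * theta (⇑φ) f + theta (⇑φ) (1 - e) * theta (⇑φ) (1 - f) := by
  have hA : (-1 : Aˣ) ≠ 1 := fun h => by
    have h1 : (-1 : A) = 1 := by simpa using congrArg Units.val h
    have h2 : (2 : ℂ) • (1 : A) = 0 := by
      rw [two_smul]
      nth_rewrite 1 [← h1]
      exact neg_add_cancel 1
    exact one_ne_zero ((smul_eq_zero.1 h2).resolve_left two_ne_zero)
  have hadd : IsIdempotentElem (e + f) := he.add hf (by rw [hef, hfe, add_zero])
  have hneg := φ.map_neg_one_units hA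
  rw [sub_sub, theta_one_sub φ hneg hadd, theta_one_sub φ hneg he, theta_one_sub φ hneg hf,
    theta_of_isIdempotentElem _ hadd, theta_of_isIdempotentElem _ he,
    theta_of_isIdempotentElem _ hf, symUnit_add he hf hef]
  simp only [map_mul, Units.val_mul, smul_mul_smul_comm, ← smul_add]
  generalize (φ (symUnit he) : B) = u
  generalize (φ (symUnit hf) : B) = v
  have h1 : (1 - u) * (1 + v) + (1 + u) * (1 - v) = (2 : ℂ) • (1 - u * v) := by
    rw [two_smul]; noncomm_ring
  have h2 : (1 - u) * (1 - v) + (1 + u) * (1 + v) = (2 : ℂ) • (1 + u * v) := by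
    rw [two_smul]; noncomm_ring
  rw [h1, h2, smul_smul, smul_smul]
  norm_num

end
end

section
/- Let A and B be simple unital complex C*-algebras, φ : GL(A) → GL(B) a group isomorphism, and θ the induced map on idempotents. Suppose e, f, g ∈ Ĩ(A) are pairwise orthogonal nontrivial idempotents with e + f + g ≠ 1 which are pairwise ∼_c-equivalent. Then e + f + g ∈ Ĩ(A) and e ∼_c (e + f + g), i.e. c_e = c_{e+f+g} for any choices of coefficient maps. -/
noncomputable section

/-- `a` and `b` are coefficient maps for the idempotent `e` (w.r.t. `φ`):
`φ(λe + 1 - e) = a(λ) θ(e) + b(λ) θ(1-e)` for all nonzero `λ`. -/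
def IsCoeffMaps {A B : Type*} [Ring A] [Ring B] [Algebra ℂ A] [Algebra ℂ B]
    (φ : Aˣ → Bˣ) (e : A) (a b : ℂˣ →* ℂˣ) : Prop :=
  ∀ (lam : ℂˣ) (v : Aˣ), (v : A) = (lam : ℂ) • e + 1 - e →
    (φ v : B) = ((a lam : ℂˣ) : ℂ) • theta φ e + ((b lam : ℂˣ) : ℂ) • theta φ (1 - e)

/-- `c(λ) = a(λ) b(λ)⁻¹`, as an element of `ℂˣ`. -/
def cOf (a b : ℂˣ →* ℂˣ) (lam : ℂˣ) : ℂˣ := a lam * (b lam)⁻¹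

/-- `e ∼_c f`: the functions `c_e` and `c_f` agree (for some, equivalently any,
choice of coefficient maps). -/
def cEquiv {A B : Type*} [Ring A] [Ring B] [Algebra ℂ A] [Algebra ℂ B]
    (φ : Aˣ → Bˣ) (e f : A) : Prop :=
  ∃ ae be af bf : ℂˣ →* ℂˣ, IsCoeffMaps φ e ae be ∧ IsCoeffMaps φ f af bf ∧
    ∀ lam : ℂˣ, cOf ae be lam = cOf af bf lam

theorem exists_mul_mul_ne_zero {R : Type*} [Ring R] [IsSimpleRing R] {x y : R}
    (hx : x ≠ 0) (hy : y ≠ 0) : ∃ b, x * b * y ≠ 0 := by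
  by_contra! h
  let I : TwoSidedIdeal R := TwoSidedIdeal.mk' {z | ∀ b, x * b * z = 0} (by simp)
    (fun {a b} ha hb c => by rw [mul_add, ha c, hb c, add_zero])
    (fun {a} ha c => by rw [mul_neg, ha c, neg_zero])
    (fun {a b} hb c => by rw [← mul_assoc, mul_assoc x c a, hb])
    (fun {a b} ha c => by rw [← mul_assoc, ha c, zero_mul])
  have hyI : y ∈ I := (TwoSidedIdeal.mem_mk' _ _ _ _ _ _ _).2 h
  have h1 : (1 : R) ∈ I := by
    rcases eq_bot_or_eq_top I with hI | hI
    · rw [hI, TwoSidedIdeal.mem_bot] at hyI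
      exact absurd hyI hy
    · rw [hI]; trivial
  have h2 := (TwoSidedIdeal.mem_mk' _ _ _ _ _ _ _).1 h1 1
  exact hx (by simpa using h2)

/-- The unit `1 + t` for `t` of square zero. -/
def oneAddUnit {R : Type*} [Ring R] (t : R) (ht : t * t = 0) : Rˣ where
  val := 1 + t
  inv := 1 - t
  val_inv := by
    have : (1 + t) * (1 - t) = 1 - t * t := by noncomm_ring
    rw [this, ht, sub_zero]
  inv_val := by
    have : (1 - t) * (1 + t) = 1 - t * t := by noncomm_ring
    rw [this, ht, sub_zero]

section UnitGroupIso

variable {R S : Type*} [Ring R] [Ring S] [Algebra ℂ S]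

theorem map_symUnit (φ : Rˣ → Sˣ) {e : R} (he : IsIdempotentElem e) :
    (φ (symUnit he) : S) = 1 - (2 : ℂ) • theta φ e := by
  rw [theta, dif_pos he, smul_smul, mul_inv_cancel₀ two_ne_zero, one_smul, sub_sub_cancel]

theorem isIdempotentElem_theta (φ : Rˣ ≃* Sˣ) {e : R} (he : IsIdempotentElem e) :
    IsIdempotentElem (theta φ e) := by
  have h : (φ (symUnit he) : S) * φ (symUnit he) = 1 := by
    rw [← Units.val_mul, ← map_mul, show symUnit he * symUnit he = 1 from
      Units.ext (symUnit he).val_inv, map_one, Units.val_one]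
  rw [map_symUnit] at h
  simp only [sub_mul, mul_sub, one_mul, mul_one, smul_mul_assoc, mul_smul_comm] at h
  have h4 : (4 : ℂ) • (theta φ e * theta φ e - theta φ e) = 0 := by
    linear_combination (norm := module) h
  exact sub_eq_zero.1 ((smul_eq_zero_iff_right (by norm_num)).1 h4)

theorem theta_zero (φ : Rˣ ≃* Sˣ) : theta φ (0 : R) = 0 := by
  have h : symUnit (IsIdempotentElem.zero (M₀ := R)) = 1 := Units.ext (by simp [symUnit])
  rw [theta, dif_pos IsIdempotentElem.zero, h]
  simp

theorem symUnit_mul_symUnit {e f : R} (he : IsIdempotentElem e) (hf : IsIdempotentElem f)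
    (hs : IsIdempotentElem (e + f)) (hef : e * f = 0) :
    symUnit he * symUnit hf = symUnit hs := Units.ext (by
  have : (1 - 2 * e) * (1 - 2 * f) = 1 - 2 * (e + f) + 4 * (e * f) := by noncomm_ring
  simpa [symUnit, hef] using this)

theorem commute_theta (φ : Rˣ ≃* Sˣ) {e f : R} (he : IsIdempotentElem e)
    (hf : IsIdempotentElem f) (hef : e * f = 0) (hfe : f * e = 0) :
    Commute (theta φ e) (theta φ f) := by
  have hs : IsIdempotentElem (e + f) := by
    simp [IsIdempotentElem, add_mul, mul_add, he.eq, hf.eq, hef, hfe]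
  have hs' : IsIdempotentElem (f + e) := add_comm e f ▸ hs
  have h1 : symUnit he * symUnit hf = symUnit hf * symUnit he := by
    rw [symUnit_mul_symUnit he hf hs hef, symUnit_mul_symUnit hf he hs' hfe]
    exact Units.ext (by simp [symUnit, add_comm])
  have h2 : (φ (symUnit he) : S) * φ (symUnit hf) = φ (symUnit hf) * φ (symUnit he) := by
    rw [← Units.val_mul, ← Units.val_mul, ← map_mul, ← map_mul, h1]
  rw [theta, theta, dif_pos he, dif_pos hf]
  exact (((Commute.one_right _).sub_right
    ((Commute.one_left _).sub_left (h2 : Commute _ _))).smul_right _).smul_left _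

theorem eq_of_smul_one_add_smul_eq {E : S} (hE : IsIdempotentElem E) (h0 : E ≠ 0)
    (h1 : 1 - E ≠ 0) {b b' c c' : ℂ} (hb : b ≠ 0)
    (h : b • (1 + (c - 1) • E) = b' • (1 + (c' - 1) • E)) : c = c' := by
  have hl : (b - b') • (1 - E) = 0 := by
    have := congrArg (· * (1 - E)) h
    simp only [smul_mul_assoc, add_mul, one_mul, hE.mul_one_sub_self, smul_zero, add_zero] at this
    rw [sub_smul, this, sub_self]
  have hr : (b * c - b' * c') • E = 0 := by
    have := congrArg (· * E) h
    simp only [smul_mul_assoc, add_mul, one_mul, hE.eq] at this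
    linear_combination (norm := module) this
  have hbb : b = b' := sub_eq_zero.1 ((smul_eq_zero_iff_left h1).1 hl)
  have := sub_eq_zero.1 ((smul_eq_zero_iff_left h0).1 hr)
  rw [← hbb] at this
  exact mul_left_cancel₀ hb this

variable [Algebra ℂ R]

theorem map_neg_one_of_isSimpleRing [Nontrivial R] [IsSimpleRing S] (φ : Rˣ ≃* Sˣ) :
    φ (-1) = -1 := by
  set z : S := ((φ (-1) : Sˣ) : S) with hz
  have hzz : z * z = 1 := by
    rw [hz, ← Units.val_mul, ← map_mul]; simp
  have hcomm (u : Sˣ) : (u : S) * z = z * u := by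
    rw [hz, ← Units.val_mul, ← Units.val_mul, ← φ.apply_symm_apply u, ← map_mul, ← map_mul]
    simp
  by_cases hm : (1 - z) = 0
  · have h1 : φ (-1) = φ 1 := by
      rw [map_one]; exact Units.ext (sub_eq_zero.1 hm).symm
    have h2 : (-1 : R) = 1 := congrArg Units.val (φ.injective h1)
    have h3 : (2 : ℂ) • (1 : R) = 0 := by
      rw [two_smul]; nth_rw 1 [← h2]; simp
    exact absurd ((smul_eq_zero_iff_right two_ne_zero).1 h3) one_ne_zero
  by_cases hp : (1 + z) = 0
  · exact Units.ext (by rw [← hz, Units.val_neg, Units.val_one]; exact eq_neg_of_add_eq_zero_right hp)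
  exfalso
  obtain ⟨b, hb⟩ := exists_mul_mul_ne_zero hm hp
  set t := (1 - z) * b * (1 + z) with ht
  have hpm : (1 + z) * (1 - z) = 0 := by
    have : (1 + z) * (1 - z) = 1 - z * z := by noncomm_ring
    rw [this, hzz, sub_self]
  have htt : t * t = 0 := by
    have : t * t = (1 - z) * b * ((1 + z) * (1 - z)) * b * (1 + z) := by
      rw [ht]; noncomm_ring
    rw [this, hpm]; simp
  have htz : t * z = t := by
    have : t * z = (1 - z) * b * (z + z * z) := by rw [ht]; noncomm_ring
    rw [this, hzz, ht, add_comm]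
  have hzt : z * t = -t := by
    have : z * t = (z - z * z) * b * (1 + z) := by rw [ht]; noncomm_ring
    rw [this, hzz, ht]; noncomm_ring
  have h := hcomm (oneAddUnit t htt)
  have h' : (1 + t) * z = z * (1 + t) := h
  rw [add_mul, mul_add, htz, hzt, one_mul, mul_one, add_right_inj] at h'
  have h3 : (2 : ℂ) • t = 0 := by
    rw [two_smul]; nth_rw 1 [h']; simp
  exact hb ((smul_eq_zero_iff_right two_ne_zero).1 h3)

theorem theta_injOn (φ : Rˣ ≃* Sˣ) {e f : R} (he : IsIdempotentElem e) (hf : IsIdempotentElem f)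
    (h : theta φ e = theta φ f) : e = f := by
  have h1 : φ (symUnit he) = φ (symUnit hf) :=
    Units.ext (by rw [map_symUnit, map_symUnit, h])
  have h2 : 1 - 2 * e = 1 - 2 * f := congrArg Units.val (φ.injective h1)
  have h3 : (2 : ℂ) • (e - f) = 0 := by
    rw [two_mul, two_mul] at h2
    linear_combination (norm := module) -h2
  exact sub_eq_zero.1 ((smul_eq_zero_iff_right two_ne_zero).1 h3)

theorem theta_one_sub_s12 [Nontrivial R] [IsSimpleRing S] (φ : Rˣ ≃* Sˣ) {e : R}
    (he : IsIdempotentElem e) : theta φ (1 - e) = 1 - theta φ e := by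
  have h : symUnit he.one_sub = -1 * symUnit he := Units.ext (by
    simp only [symUnit, Units.val_mul, Units.val_neg, Units.val_one]; noncomm_ring)
  have h1 := map_symUnit φ he.one_sub
  rw [h, map_mul, map_neg_one_of_isSimpleRing, Units.val_mul, map_symUnit] at h1
  simp only [Units.val_neg, Units.val_one, neg_mul, one_mul] at h1
  have h3 : (2 : ℂ) • (theta φ (1 - e) - (1 - theta φ e)) = 0 := by
    linear_combination (norm := module) h1
  exact sub_eq_zero.1 ((smul_eq_zero_iff_right two_ne_zero).1 h3)

theorem theta_ne_zero (φ : Rˣ ≃* Sˣ) {e : R} (he : IsIdempotentElem e) (h0 : e ≠ 0) :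
    theta φ e ≠ 0 := fun h =>
  h0 (theta_injOn φ he IsIdempotentElem.zero (h.trans (theta_zero φ).symm))

theorem one_sub_theta_ne_zero [Nontrivial R] [IsSimpleRing S] (φ : Rˣ ≃* Sˣ) {e : R}
    (he : IsIdempotentElem e) (h1 : e ≠ 1) : 1 - theta φ e ≠ 0 := by
  rw [← theta_one_sub_s12 φ he]
  exact theta_ne_zero φ he.one_sub (sub_ne_zero.2 h1.symm)

/-- The unit `λe + 1 - e` for an idempotent `e` and `λ ≠ 0`. -/
def scaleUnit {e : R} (he : IsIdempotentElem e) (l : ℂˣ) : Rˣ where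
  val := (l : ℂ) • e + 1 - e
  inv := ((l⁻¹ : ℂˣ) : ℂ) • e + 1 - e
  val_inv := by
    simp only [sub_mul, add_mul, mul_sub, mul_add, smul_mul_assoc, mul_smul_comm, he.eq, one_mul,
      mul_one, smul_add, smul_sub, smul_smul, Units.inv_mul, one_smul]
    abel
  inv_val := by
    simp only [sub_mul, add_mul, mul_sub, mul_add, smul_mul_assoc, mul_smul_comm, he.eq, one_mul,
      mul_one, smul_add, smul_sub, smul_smul, Units.mul_inv, one_smul]
    abel

theorem IsCoeffMaps.map_scaleUnit [Nontrivial R] [IsSimpleRing S] {φ : Rˣ ≃* Sˣ} {e : R}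
    (he : IsIdempotentElem e) {a b : ℂˣ →* ℂˣ} (h : IsCoeffMaps φ e a b) (l : ℂˣ) :
    (φ (scaleUnit he l) : S) =
      ((b l : ℂˣ) : ℂ) • (1 + ((cOf a b l : ℂˣ) - 1 : ℂ) • theta φ e) := by
  rw [h l (scaleUnit he l) rfl, theta_one_sub_s12 φ he]
  have h2 : ((b l : ℂˣ) : ℂ) * (cOf a b l : ℂˣ) = a l := by
    rw [← Units.val_mul, cOf, mul_comm, inv_mul_cancel_right]
  rw [← h2]
  module

theorem IsCoeffMaps.cOf_eq [Nontrivial R] [IsSimpleRing S] {φ : Rˣ ≃* Sˣ} {e : R}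
    (he : IsIdempotentElem e) (h0 : e ≠ 0) (h1 : e ≠ 1) {a b a' b' : ℂˣ →* ℂˣ}
    (h : IsCoeffMaps φ e a b) (h' : IsCoeffMaps φ e a' b') (l : ℂˣ) :
    cOf a b l = cOf a' b' l :=
  Units.ext (eq_of_smul_one_add_smul_eq (isIdempotentElem_theta φ he) (theta_ne_zero φ he h0)
    (one_sub_theta_ne_zero φ he h1) (b l).ne_zero
    ((h.map_scaleUnit he l).symm.trans (h'.map_scaleUnit he l)))

/-- If `φ` scales `θ(e)` and `θ(f)` by the same ratio `c` with `c² ≠ 1`, then the idempotents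
`θ(e)`, `θ(f)` or their complements are orthogonal. -/
theorem theta_mul_theta_eq_zero_or [IsSimpleRing S] (φ : Rˣ ≃* Sˣ) {e f : R}
    (he : IsIdempotentElem e) (hf : IsIdempotentElem f) (hef : e * f = 0) (hfe : f * e = 0)
    {l : ℂˣ} {b b' c : ℂ}
    (h : (φ (scaleUnit he l) : S) = b • (1 + (c - 1) • theta φ e))
    (h' : (φ (scaleUnit hf l) : S) = b' • (1 + (c - 1) • theta φ f))
    (hb : b ≠ 0) (hb' : b' ≠ 0) (hc : c * c ≠ 1) :
    theta φ e * theta φ f = 0 ∨ (1 - theta φ e) * (1 - theta φ f) = 0 := by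
  have hE := isIdempotentElem_theta φ he
  have hF := isIdempotentElem_theta φ hf
  have hEF := commute_theta φ he hf hef hfe
  have hse := map_symUnit φ he
  have hsf := map_symUnit φ hf
  set E := theta φ e
  set F := theta φ f
  by_contra! hne
  obtain ⟨d, hd⟩ := exists_mul_mul_ne_zero hne.2 hne.1
  set t := (1 - E) * (1 - F) * d * (E * F) with ht
  have hEt : E * t = 0 := by
    rw [ht, mul_assoc (1 - E), mul_assoc (1 - E), ← mul_assoc E, hE.mul_one_sub_self, zero_mul]
  have hFt : F * t = 0 := by
    have : (1 - E) * (1 - F) = (1 - F) * (1 - E) :=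
      ((Commute.one_right _).sub_right ((Commute.one_left _).sub_left hEF))
    rw [ht, this, mul_assoc (1 - F), mul_assoc (1 - F), ← mul_assoc F, hF.mul_one_sub_self,
      zero_mul]
  have htF : t * F = t := by
    rw [ht, mul_assoc, mul_assoc E, hF.eq]
  have htE : t * E = t := by
    rw [ht, mul_assoc, hEF.eq, mul_assoc F, hE.eq]
  have htt : t * t = 0 := by
    nth_rw 1 [← htE]; rw [mul_assoc, hEt, mul_zero]
  have hcomm : (oneAddUnit t htt) * φ (symUnit he * symUnit hf) =
      φ (symUnit he * symUnit hf) * (oneAddUnit t htt) := by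
    refine Units.ext ?_
    simp only [map_mul, Units.val_mul, hse, hsf]
    change (1 + t) * _ = _ * (1 + t)
    have h1 : t * ((1 - (2 : ℂ) • E) * (1 - (2 : ℂ) • F)) = t := by
      rw [← mul_assoc, mul_sub t, mul_one, mul_smul_comm, htE, mul_sub, mul_one, mul_smul_comm,
        sub_mul, smul_mul_assoc, htF]
      module
    have h2 : (1 - (2 : ℂ) • E) * (1 - (2 : ℂ) • F) * t = t := by
      rw [mul_assoc, sub_mul _ _ t, one_mul, smul_mul_assoc, hFt, smul_zero, sub_zero, sub_mul,
        one_mul, smul_mul_assoc, hEt, smul_zero, sub_zero]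
    rw [add_mul, mul_add, h1, h2, one_mul, mul_one]
  obtain ⟨u, hu⟩ := φ.surjective (oneAddUnit t htt)
  rw [← hu, ← map_mul, ← map_mul] at hcomm
  have hcu : Commute (u : R) (e + f) := by
    have h1 := congrArg Units.val (φ.injective hcomm)
    have hs : (1 - 2 * e) * (1 - 2 * f) = 1 - (2 : ℂ) • (e + f) := by
      have : (1 - 2 * e) * (1 - 2 * f) = 1 - (e + f + (e + f)) + 4 * (e * f) := by noncomm_ring
      rw [this, hef, two_smul, mul_zero, add_zero]
    change (u : R) * ((1 - 2 * e) * (1 - 2 * f)) = (1 - 2 * e) * (1 - 2 * f) * u at h1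
    rw [hs, mul_sub, sub_mul, one_mul, mul_one, sub_right_inj, mul_smul_comm,
      smul_mul_assoc] at h1
    exact smul_right_injective R (two_ne_zero (α := ℂ)) h1
  have hcv : u * (scaleUnit he l * scaleUnit hf l) = scaleUnit he l * scaleUnit hf l * u := by
    refine Units.ext ?_
    have hs : ((l : ℂ) • e + 1 - e) * ((l : ℂ) • f + 1 - f) = 1 + ((l : ℂ) - 1) • (e + f) := by
      simp only [sub_mul, add_mul, mul_sub, mul_add, smul_mul_assoc, mul_smul_comm, hef, one_mul,
        mul_one]
      module
    change (u : R) * (((l : ℂ) • e + 1 - e) * ((l : ℂ) • f + 1 - f)) =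
      ((l : ℂ) • e + 1 - e) * ((l : ℂ) • f + 1 - f) * u
    rw [hs]
    exact (Commute.one_right _).add_right (hcu.smul_right _)
  have h1 := congrArg Units.val (congrArg φ hcv)
  rw [map_mul, map_mul, map_mul, map_mul, hu, Units.val_mul, Units.val_mul, Units.val_mul,
    Units.val_mul, h, h'] at h1
  change (1 + t) * _ = _ * (1 + t) at h1
  rw [smul_mul_smul_comm, mul_smul_comm, smul_mul_assoc] at h1
  have h2 := smul_right_injective S (mul_ne_zero hb hb') h1
  rw [add_mul 1 t, mul_add _ 1 t, one_mul, mul_one, add_right_inj] at h2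
  have h3 : t * ((1 + (c - 1) • E) * (1 + (c - 1) • F)) = (c * c) • t := by
    rw [← mul_assoc, mul_add t, mul_one, mul_smul_comm, htE, mul_add, mul_one, mul_smul_comm,
      add_mul, smul_mul_assoc, htF]
    module
  have h4 : (1 + (c - 1) • E) * (1 + (c - 1) • F) * t = t := by
    rw [mul_assoc, add_mul _ _ t, one_mul, smul_mul_assoc, hFt, smul_zero, add_zero, add_mul,
      one_mul, smul_mul_assoc, hEt, smul_zero, add_zero]
  rw [h3, h4] at h2
  have h5 : (c * c - 1) • t = 0 := by rw [sub_smul, one_smul, h2, sub_self]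
  exact hc (sub_eq_zero.1 ((smul_eq_zero_iff_left hd).1 h5))

end UnitGroupIso

section ThreeIdempotents

variable {S : Type*} [Ring S]

theorem eq_zero_or_one_sub_eq_zero_of_mixed {E F G : S} (hFE : F * E = 0)
    (hEG : (1 - E) * (1 - G) = 0) (hFG : F * G = 0 ∨ (1 - F) * (1 - G) = 0) :
    F = 0 ∨ 1 - G = 0 := by
  have h : F * (1 - G) = 0 := by
    have : F * ((1 - E) * (1 - G)) = F * (1 - G) - F * E * (1 - G) := by noncomm_ring
    rw [hEG, hFE] at this
    simpa using this.symm
  rcases hFG with hFG | hFG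
  · left; simpa [mul_sub, hFG] using h
  · right; simpa [sub_mul, h] using hFG

theorem pairwise_orthogonal_or_compl {E F G : S} (hEF : Commute E F) (hEG : Commute E G)
    (hFG : Commute F G) (hE0 : E ≠ 0) (hF0 : F ≠ 0) (hG0 : G ≠ 0) (hE1 : 1 - E ≠ 0)
    (hF1 : 1 - F ≠ 0) (hG1 : 1 - G ≠ 0)
    (h₁ : E * F = 0 ∨ (1 - E) * (1 - F) = 0) (h₂ : E * G = 0 ∨ (1 - E) * (1 - G) = 0)
    (h₃ : F * G = 0 ∨ (1 - F) * (1 - G) = 0) :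
    (E * F = 0 ∧ E * G = 0 ∧ F * G = 0) ∨
      ((1 - E) * (1 - F) = 0 ∧ (1 - E) * (1 - G) = 0 ∧ (1 - F) * (1 - G) = 0) := by
  have swap {X Y : S} (h : Commute X Y) : (1 - X) * (1 - Y) = (1 - Y) * (1 - X) :=
    (Commute.one_right _).sub_right ((Commute.one_left _).sub_left h)
  have key {X Y Z : S} (hYX : Y * X = 0) (hXZ : (1 - X) * (1 - Z) = 0)
      (hYZ : Y * Z = 0 ∨ (1 - Y) * (1 - Z) = 0) (hY : Y ≠ 0) (hZ : 1 - Z ≠ 0) : False :=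
    (eq_zero_or_one_sub_eq_zero_of_mixed hYX hXZ hYZ).elim hY hZ
  rcases h₁ with a | a <;> rcases h₂ with b | b <;> rcases h₃ with d | d
  · exact .inl ⟨a, b, d⟩
  · exact (key a d (.inl b) hE0 hG1).elim
  · exact (key (hEF.eq ▸ a) b (.inl d) hF0 hG1).elim
  · exact (key (hEF.eq ▸ a) b (.inr d) hF0 hG1).elim
  · exact (key (hEG.eq ▸ b) a (.inl (hFG.eq ▸ d)) hG0 hF1).elim
  · exact (key (hEG.eq ▸ b) a (.inr (swap hFG ▸ d)) hG0 hF1).elim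
  · exact (key (hFG.eq ▸ d) (swap hEF ▸ a) (.inr (swap hEG ▸ b)) hG0 hE1).elim
  · exact .inr ⟨a, b, d⟩

variable [Algebra ℂ S]

theorem one_add_smul_mul_of_orthogonal {E F G : S} (hEF : E * F = 0) (hEG : E * G = 0)
    (hFG : F * G = 0) (r : ℂ) :
    (1 + r • E) * (1 + r • F) * (1 + r • G) = 1 + r • (E + F + G) := by
  simp only [add_mul, mul_add, smul_mul_assoc, mul_smul_comm, hEF, hEG, hFG, one_mul, mul_one,
    smul_zero, zero_mul]
  module

/-- Three pairwise orthogonal (or pairwise co-orthogonal) idempotents and the idempotent `P` whose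
symmetry is the product of their symmetries: scaling all three by `c` scales `P` by `c` too, up to
a scalar factor. -/
theorem exists_one_add_smul_mul_eq {E F G P : S}
    (h : (E * F = 0 ∧ E * G = 0 ∧ F * G = 0) ∨
      ((1 - E) * (1 - F) = 0 ∧ (1 - E) * (1 - G) = 0 ∧ (1 - F) * (1 - G) = 0))
    (hP : (1 - (2 : ℂ) • E) * (1 - (2 : ℂ) • F) * (1 - (2 : ℂ) • G) = 1 - (2 : ℂ) • P)
    {c : ℂ} (hc : c ≠ 0) :
    ∃ k : ℂ, (1 + (c - 1) • E) * (1 + (c - 1) • F) * (1 + (c - 1) • G) =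
      k • (1 + (c - 1) • P) := by
  rcases h with ⟨h1, h2, h3⟩ | ⟨h1, h2, h3⟩
  · have hm := one_add_smul_mul_of_orthogonal h1 h2 h3 (-2)
    simp only [neg_smul, ← sub_eq_add_neg] at hm
    rw [hP, sub_right_inj] at hm
    have hPE := smul_right_injective S (two_ne_zero (α := ℂ)) hm
    exact ⟨1, by rw [one_smul, one_add_smul_mul_of_orthogonal h1 h2 h3, hPE]⟩
  · have hscale (X : S) : 1 + (c - 1) • X = c • (1 + (c⁻¹ - 1) • (1 - X)) := by
      rw [smul_add, smul_smul, mul_sub, mul_inv_cancel₀ hc]; module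
    have hneg (X : S) : 1 - (2 : ℂ) • X = -(1 + (-2 : ℂ) • (1 - X)) := by module
    rw [hneg E, hneg F, hneg G, neg_mul_neg, mul_neg,
      one_add_smul_mul_of_orthogonal h1 h2 h3] at hP
    have hPE : (1 - P) = (1 - E + (1 - F) + (1 - G)) := by
      refine smul_right_injective S (two_ne_zero (α := ℂ)) ?_
      linear_combination (norm := module) -hP
    refine ⟨c * c, ?_⟩
    rw [hscale E, hscale F, hscale G, smul_mul_smul_comm, smul_mul_smul_comm,
      one_add_smul_mul_of_orthogonal h1 h2 h3, ← hPE, hscale P, smul_smul]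

theorem exists_one_add_smul_mul_eq_of_sq_eq_one {E F G P : S}
    (hP : (1 - (2 : ℂ) • E) * (1 - (2 : ℂ) • F) * (1 - (2 : ℂ) • G) = 1 - (2 : ℂ) • P)
    {c : ℂ} (hc : c * c = 1) :
    ∃ k : ℂ, (1 + (c - 1) • E) * (1 + (c - 1) • F) * (1 + (c - 1) • G) =
      k • (1 + (c - 1) • P) := by
  refine ⟨1, ?_⟩
  rcases mul_self_eq_one_iff.1 hc with rfl | rfl
  · simp
  · have : (-1 - 1 : ℂ) = -2 := by norm_num
    simp only [this, neg_smul, ← sub_eq_add_neg, one_smul, hP]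

end ThreeIdempotents

variable {A B : Type*}
  [NormedRing A] [StarRing A] [CStarRing A] [CompleteSpace A]
  [NormedAlgebra ℂ A] [StarModule ℂ A]
  [NormedRing B] [StarRing B] [CStarRing B] [CompleteSpace B]
  [NormedAlgebra ℂ B] [StarModule ℂ B]


theorem statement12 [IsSimpleRing A] [IsSimpleRing B] (φ : Aˣ ≃* Bˣ)
    (e f g : A) (he : IsIdempotentElem e) (he0 : e ≠ 0) (he1 : e ≠ 1)
    (hf : IsIdempotentElem f) (hf0 : f ≠ 0) (hf1 : f ≠ 1)
    (hg : IsIdempotentElem g) (hg0 : g ≠ 0) (hg1 : g ≠ 1)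
    (hef : e * f = 0) (hfe : f * e = 0) (heg : e * g = 0) (hge : g * e = 0)
    (hfg : f * g = 0) (hgf : g * f = 0) (hone : e + f + g ≠ 1)
    (hcef : cEquiv (⇑φ) e f) (hceg : cEquiv (⇑φ) e g) (hcfg : cEquiv (⇑φ) f g) :
    (IsIdempotentElem (e + f + g) ∧ e + f + g ≠ 0 ∧ e + f + g ≠ 1) ∧
    ∀ ae be as bs : ℂˣ →* ℂˣ, IsCoeffMaps (⇑φ) e ae be →
      IsCoeffMaps (⇑φ) (e + f + g) as bs →
        ∀ lam : ℂˣ, cOf ae be lam = cOf as bs lam := by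
  have hs : IsIdempotentElem (e + f) := by
    simp [IsIdempotentElem, add_mul, mul_add, he.eq, hf.eq, hef, hfe]
  have hsg : (e + f) * g = 0 := by rw [add_mul, heg, hfg, add_zero]
  have hp : IsIdempotentElem (e + f + g) := by
    simp [IsIdempotentElem, add_mul, mul_add, he.eq, hf.eq, hg.eq, hef, hfe, heg, hge, hfg, hgf]
  have hp0 : e + f + g ≠ 0 := fun h => he0 <| by
    simpa [mul_add, he.eq, hef, heg] using congrArg (e * ·) h
  refine ⟨⟨hp, hp0, hone⟩, fun ae be as bs hae has l => ?_⟩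
  obtain ⟨a₁, b₁, a₂, b₂, hm₁, hm₂, h₁₂⟩ := hcef
  obtain ⟨a₁', b₁', a₃, b₃, hm₁', hm₃, h₁₃⟩ := hceg
  have hv₁ := hae.map_scaleUnit he l
  have hv₂ := hm₂.map_scaleUnit hf l
  have hv₃ := hm₃.map_scaleUnit hg l
  have hvp := has.map_scaleUnit hp l
  rw [← h₁₂ l, ← hae.cOf_eq he he0 he1 hm₁] at hv₂
  rw [← h₁₃ l, ← hae.cOf_eq he he0 he1 hm₁'] at hv₃
  have hP : (1 - (2 : ℂ) • theta φ e) * (1 - (2 : ℂ) • theta φ f) * (1 - (2 : ℂ) • theta φ g) =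
      1 - (2 : ℂ) • theta φ (e + f + g) := by
    rw [← map_symUnit φ he, ← map_symUnit φ hf, ← map_symUnit φ hg, ← map_symUnit φ hp,
      ← Units.val_mul, ← Units.val_mul, ← map_mul, ← map_mul, symUnit_mul_symUnit he hf hs hef,
      symUnit_mul_symUnit hs hg hp hsg]
  have hprod : scaleUnit he l * scaleUnit hf l * scaleUnit hg l = scaleUnit hp l := by
    refine Units.ext ?_
    change ((l : ℂ) • e + 1 - e) * ((l : ℂ) • f + 1 - f) * ((l : ℂ) • g + 1 - g) =
      (l : ℂ) • (e + f + g) + 1 - (e + f + g)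
    have hx (x : A) : (l : ℂ) • x + 1 - x = 1 + ((l : ℂ) - 1) • x := by module
    simp only [hx]
    exact one_add_smul_mul_of_orthogonal hef heg hfg _
  obtain ⟨k, hk⟩ : ∃ k : ℂ, (1 + ((cOf ae be l : ℂˣ) - 1 : ℂ) • theta φ e) *
      (1 + ((cOf ae be l : ℂˣ) - 1 : ℂ) • theta φ f) *
      (1 + ((cOf ae be l : ℂˣ) - 1 : ℂ) • theta φ g) =
      k • (1 + ((cOf ae be l : ℂˣ) - 1 : ℂ) • theta φ (e + f + g)) := by
    by_cases hc : ((cOf ae be l : ℂˣ) : ℂ) * (cOf ae be l : ℂˣ) = 1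
    · exact exists_one_add_smul_mul_eq_of_sq_eq_one hP hc
    · exact exists_one_add_smul_mul_eq (pairwise_orthogonal_or_compl
        (commute_theta φ he hf hef hfe) (commute_theta φ he hg heg hge)
        (commute_theta φ hf hg hfg hgf) (theta_ne_zero φ he he0) (theta_ne_zero φ hf hf0)
        (theta_ne_zero φ hg hg0) (one_sub_theta_ne_zero φ he he1)
        (one_sub_theta_ne_zero φ hf hf1) (one_sub_theta_ne_zero φ hg hg1)
        (theta_mul_theta_eq_zero_or φ he hf hef hfe hv₁ hv₂ (be l).ne_zero (b₂ l).ne_zero hc)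
        (theta_mul_theta_eq_zero_or φ he hg heg hge hv₁ hv₃ (be l).ne_zero (b₃ l).ne_zero hc)
        (theta_mul_theta_eq_zero_or φ hf hg hfg hgf hv₂ hv₃ (b₂ l).ne_zero (b₃ l).ne_zero hc))
        hP (cOf ae be l).ne_zero
  rw [← hprod, map_mul, map_mul, Units.val_mul, Units.val_mul, hv₁, hv₂, hv₃, smul_mul_smul_comm,
    smul_mul_smul_comm, hk, smul_smul] at hvp
  exact Units.ext (eq_of_smul_one_add_smul_eq (isIdempotentElem_theta φ hp)
    (theta_ne_zero φ hp hp0) (one_sub_theta_ne_zero φ hp hone) (bs l).ne_zero hvp.symm).symm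

end
end
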